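/- Define, for λ > 0 and x ≠ y in ℝ², E₀^±(λ)(x,y) := ±(i/4) H₀^±(λ|x−y|) − ( ±i/4 − (1/(2π)) log(λ/2) − γ/(2π) ) + (1/(2π)) log|x−y|. Then for every α with 0 < α < 1 there is a constant C such that for all real numbers b > a > 0 and all x ≠ y in ℝ²: |∂_λ E₀^±(b)(x,y) − ∂_λ E₀^±(a)(x,y)| ≤ C a^{−1/2} (b−a)^{α} |x−y|^{1/2+α}. -/

import Mathlib

open MeasureTheory Real Set Filter Complex

noncomputable section

/-- The plane `ℝ²`. -/
abbrev Plane : Type := EuclideanSpace ℝ (Fin 2)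

/-- The Bessel function of the first kind of order zero,
`J₀(z) = (1/π) ∫₀^π cos(z sin θ) dθ`. -/
def J0 (z : ℝ) : ℝ := (1 / Real.pi) * ∫ θ in (0:ℝ)..Real.pi, Real.cos (z * Real.sin θ)

/-- The Bessel function of the second kind of order zero, defined for `z > 0` by the
(improper) integral `Y₀(z) = −(2/π) lim_{T→∞} ∫₀^T cos(z cosh t) dt`. -/
def Y0 (z : ℝ) : ℝ :=
  -(2 / Real.pi) * limUnder atTop (fun T : ℝ => ∫ t in (0:ℝ)..T, Real.cos (z * Real.cosh t))

/-- The Hankel function of order zero `H₀^±(z) = J₀(z) ± iY₀(z)`; the sign `ε = ±1`. -/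
def H0 (ε : ℝ) (z : ℝ) : ℂ := (J0 z : ℂ) + ε * Complex.I * (Y0 z : ℂ)

/-- The error term `E₀^±(λ)(x,y)` in the expansion of the free resolvent
`R₀^±(λ²)(x,y) = ±(i/4)H₀^±(λ|x−y|)` around zero energy:
`E₀^± = ±(i/4)H₀^±(λ|x−y|) − (±i/4 − (1/2π)log(λ/2) − γ/2π) + (1/2π)log|x−y|`. -/
def E0 (ε : ℝ) (l : ℝ) (x y : Plane) : ℂ :=
  ε * (Complex.I / 4) * H0 ε (l * ‖x - y‖) -
    (ε * Complex.I / 4 - (1 / (2 * Real.pi)) * (Real.log (l / 2) : ℂ) -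
      (Real.eulerMascheroniConstant / (2 * Real.pi) : ℝ)) +
    (1 / (2 * Real.pi)) * (Real.log ‖x - y‖ : ℂ)

/-- The oscillatory integral `∫₀^{π/2} cosⁿ θ e^{iz cos θ} dθ`. -/
def oscInt (n : ℕ) (z : ℝ) : ℂ :=
  ∫ θ in (0:ℝ)..(Real.pi / 2),
    ((Real.cos θ : ℝ) : ℂ) ^ n * Complex.exp (Complex.I * z * (Real.cos θ : ℝ))

theorem continuous_oscInt_integrand (n : ℕ) (z : ℝ) :
    Continuous fun θ : ℝ =>
      ((Real.cos θ : ℝ) : ℂ) ^ n * Complex.exp (Complex.I * z * (Real.cos θ : ℝ)) := by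
  fun_prop

theorem norm_exp_I_mul_mul_ofReal (z t : ℝ) : ‖Complex.exp (Complex.I * z * (t : ℂ))‖ = 1 := by
  rw [show Complex.I * z * (t : ℂ) = ((z * t : ℝ) : ℂ) * Complex.I by push_cast; ring]
  exact Complex.norm_exp_ofReal_mul_I _

theorem norm_oscInt_integrand_le (n : ℕ) (z θ : ℝ) :
    ‖((Real.cos θ : ℝ) : ℂ) ^ n * Complex.exp (Complex.I * z * (Real.cos θ : ℝ))‖ ≤ 1 := by
  rw [norm_mul, norm_exp_I_mul_mul_ofReal, mul_one, norm_pow, Complex.norm_real]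
  exact pow_le_one₀ (norm_nonneg _) (Real.abs_cos_le_one θ)

theorem hasDerivAt_oscInt (n : ℕ) (z : ℝ) :
    HasDerivAt (oscInt n) (Complex.I * oscInt (n + 1) z) z := by
  have key := (intervalIntegral.hasDerivAt_integral_of_dominated_loc_of_deriv_le
    (μ := volume) (a := 0) (b := Real.pi / 2) (bound := fun _ => (1 : ℝ)) (x₀ := z)
    (F := fun (z θ : ℝ) =>
      ((Real.cos θ : ℝ) : ℂ) ^ n * Complex.exp (Complex.I * z * (Real.cos θ : ℝ)))
    (F' := fun (z θ : ℝ) => Complex.I *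
      (((Real.cos θ : ℝ) : ℂ) ^ (n + 1) * Complex.exp (Complex.I * z * (Real.cos θ : ℝ))))
    Filter.univ_mem
    (Eventually.of_forall fun w => (continuous_oscInt_integrand n w).aestronglyMeasurable)
    ((continuous_oscInt_integrand n z).intervalIntegrable _ _)
    ((continuous_oscInt_integrand (n + 1) z).const_mul _).aestronglyMeasurable
    (Eventually.of_forall fun θ _ w _ => by
      rw [norm_mul, Complex.norm_I, one_mul]
      exact norm_oscInt_integrand_le _ _ _)
    (by simp) (Eventually.of_forall fun θ _ w _ => ?_)).2
  · rw [intervalIntegral.integral_const_mul] at key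
    exact key
  · have h1 : HasDerivAt (fun w : ℝ => Complex.I * (w : ℂ) * ((Real.cos θ : ℝ) : ℂ))
        (Complex.I * 1 * ((Real.cos θ : ℝ) : ℂ)) w :=
      (Complex.ofRealCLM.hasDerivAt.const_mul Complex.I).mul_const _
    refine (h1.cexp.const_mul (((Real.cos θ : ℝ) : ℂ) ^ n)).congr_deriv ?_
    ring

/-- First-derivative (van der Corput) bound away from the stationary point `θ = 0`. -/
theorem norm_oscInt_tail_le {n : ℕ} (hn : n ≠ 0) {z δ : ℝ} (hz : 0 < z) (hδ : 0 < δ)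
    (hδ' : δ ≤ Real.pi / 2) :
    ‖∫ θ in δ..(Real.pi / 2),
      ((Real.cos θ : ℝ) : ℂ) ^ n * Complex.exp (Complex.I * z * (Real.cos θ : ℝ))‖
      ≤ 4 / (z * δ) := by
  have hpi := Real.pi_pos
  have hpi4 := Real.pi_le_four
  set q : ℝ → ℝ := fun θ => Real.cos θ ^ n / Real.sin θ with hq
  set q' : ℝ → ℝ := fun θ =>
    (n * Real.cos θ ^ (n - 1) * (-Real.sin θ) * Real.sin θ - Real.cos θ ^ n * Real.cos θ) /
      Real.sin θ ^ 2 with hq'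
  have hsub : ∀ θ ∈ uIcc δ (Real.pi / 2), 0 < Real.sin θ ∧ 0 ≤ Real.cos θ := by
    intro θ hθ
    rw [uIcc_of_le hδ'] at hθ
    exact ⟨Real.sin_pos_of_pos_of_lt_pi (by linarith [hθ.1]) (by linarith [hθ.2]),
      Real.cos_nonneg_of_mem_Icc ⟨by linarith [hθ.1], hθ.2⟩⟩
  have hqd : ∀ θ ∈ uIcc δ (Real.pi / 2), HasDerivAt q (q' θ) θ := fun θ hθ =>
    ((Real.hasDerivAt_cos θ).pow n).div (Real.hasDerivAt_sin θ) (hsub θ hθ).1.ne'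
  have hq'c : ContinuousOn q' (uIcc δ (Real.pi / 2)) := by
    refine ContinuousOn.div (by fun_prop) (by fun_prop) fun θ hθ => ?_
    have := (hsub θ hθ).1
    positivity
  have hq'i : IntervalIntegrable q' volume δ (Real.pi / 2) := hq'c.intervalIntegrable
  have hq'neg : ∀ θ ∈ uIcc δ (Real.pi / 2), q' θ ≤ 0 := by
    intro θ hθ
    obtain ⟨hs, hc⟩ := hsub θ hθ
    refine div_nonpos_of_nonpos_of_nonneg ?_ (by positivity)
    have h1 : 0 ≤ n * Real.cos θ ^ (n - 1) * Real.sin θ * Real.sin θ := by positivity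
    have h2 : 0 ≤ Real.cos θ ^ n * Real.cos θ := by positivity
    linarith
  set v : ℝ → ℂ := fun θ => Complex.I / z * Complex.exp (Complex.I * z * (Real.cos θ : ℝ)) with hv
  set v' : ℝ → ℂ := fun θ =>
    ((Real.sin θ : ℝ) : ℂ) * Complex.exp (Complex.I * z * (Real.cos θ : ℝ)) with hv'
  have hzC : (z : ℂ) ≠ 0 := by exact_mod_cast hz.ne'
  have hvd : ∀ θ ∈ uIcc δ (Real.pi / 2), HasDerivAt v (v' θ) θ := by
    intro θ _
    have h1 : HasDerivAt (fun θ : ℝ => Complex.I * z * ((Real.cos θ : ℝ) : ℂ))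
        (Complex.I * z * ((-Real.sin θ : ℝ) : ℂ)) θ :=
      (Real.hasDerivAt_cos θ).ofReal_comp.const_mul _
    refine (h1.cexp.const_mul (Complex.I / z)).congr_deriv ?_
    simp only [hv']
    push_cast
    field_simp
    linear_combination (-Complex.sin θ) * Complex.I_sq
  have hvn : ∀ θ, ‖v θ‖ = 1 / z := by
    intro θ
    rw [hv]
    simp only [norm_mul, norm_exp_I_mul_mul_ofReal, norm_div, Complex.norm_I, Complex.norm_real,
      Real.norm_of_nonneg hz.le, mul_one]
  have hparts := intervalIntegral.integral_mul_deriv_eq_deriv_mul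
    (u := fun θ => ((q θ : ℝ) : ℂ)) (u' := fun θ => ((q' θ : ℝ) : ℂ)) (v := v) (v' := v')
    (a := δ) (b := Real.pi / 2)
    (fun θ hθ => (hqd θ hθ).ofReal_comp) hvd
    (Complex.continuous_ofReal.comp_continuousOn hq'c).intervalIntegrable
    ((by fun_prop : Continuous v').intervalIntegrable _ _)
  have heq : (∫ θ in δ..(Real.pi / 2),
      ((Real.cos θ : ℝ) : ℂ) ^ n * Complex.exp (Complex.I * z * (Real.cos θ : ℝ)))
      = ∫ θ in δ..(Real.pi / 2), ((q θ : ℝ) : ℂ) * v' θ := by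
    refine intervalIntegral.integral_congr fun θ hθ => ?_
    have hs : ((Real.sin θ : ℝ) : ℂ) ≠ 0 := by exact_mod_cast (hsub θ hθ).1.ne'
    simp only [hq, hv', Complex.ofReal_div, Complex.ofReal_pow]
    field_simp
  have hq0 : q (Real.pi / 2) = 0 := by simp [hq, hn]
  have hint : ‖∫ θ in δ..(Real.pi / 2), ((q' θ : ℝ) : ℂ) * v θ‖ ≤ q δ / z := by
    calc _ ≤ ∫ θ in δ..(Real.pi / 2), -q' θ * (1 / z) := by
          refine intervalIntegral.norm_integral_le_of_norm_le hδ'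
            (Eventually.of_forall fun θ hθ => ?_) (hq'i.neg.mul_const _)
          rw [norm_mul, hvn, Complex.norm_real,
            Real.norm_of_nonpos (hq'neg θ (by rw [uIcc_of_le hδ']; exact Ioc_subset_Icc_self hθ))]
      _ = q δ / z := by
          rw [intervalIntegral.integral_mul_const, intervalIntegral.integral_neg,
            intervalIntegral.integral_eq_sub_of_hasDerivAt hqd hq'i, hq0]
          ring
  have hδm : δ ∈ uIcc δ (Real.pi / 2) := left_mem_uIcc
  have hqδ0 : 0 ≤ q δ := div_nonneg (pow_nonneg (hsub δ hδm).2 _) (hsub δ hδm).1.le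
  have hqδ : q δ ≤ 2 / δ := by
    have h1 := Real.mul_le_sin hδ.le hδ'
    have h2 : δ / 2 ≤ 2 / Real.pi * δ := by
      rw [div_mul_eq_mul_div, div_le_div_iff₀ two_pos hpi]
      nlinarith
    calc q δ ≤ 1 / Real.sin δ := by
          refine div_le_div_of_nonneg_right ?_ (hsub δ hδm).1.le
          exact pow_le_one₀ (hsub δ hδm).2 (Real.cos_le_one _)
      _ ≤ 1 / (δ / 2) := one_div_le_one_div_of_le (by positivity) (h2.trans h1)
      _ = 2 / δ := by field_simp
  rw [heq, hparts, hq0, Complex.ofReal_zero, zero_mul, zero_sub]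
  calc _ ≤ ‖-(((q δ : ℝ) : ℂ) * v δ)‖ + ‖∫ θ in δ..(Real.pi / 2), ((q' θ : ℝ) : ℂ) * v θ‖ :=
        norm_sub_le _ _
    _ ≤ q δ / z + q δ / z := by
        refine add_le_add (le_of_eq ?_) hint
        rw [norm_neg, norm_mul, hvn, Complex.norm_real, Real.norm_of_nonneg hqδ0]
        ring
    _ ≤ 2 / δ / z + 2 / δ / z := by gcongr
    _ = 4 / (z * δ) := by field_simp; norm_num

theorem norm_oscInt_le {n : ℕ} (hn : n ≠ 0) {z : ℝ} (hz : 0 < z) :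
    ‖oscInt n z‖ ≤ 5 / √z := by
  have hpi := Real.pi_gt_three
  have hpi4 := Real.pi_le_four
  have hs : 0 < √z := Real.sqrt_pos.2 hz
  have hhead : ∀ δ, 0 ≤ δ → ‖∫ θ in (0:ℝ)..δ,
      ((Real.cos θ : ℝ) : ℂ) ^ n * Complex.exp (Complex.I * z * (Real.cos θ : ℝ))‖ ≤ δ := by
    intro δ hδ
    have := intervalIntegral.norm_integral_le_of_norm_le_const (a := 0) (b := δ)
      fun θ _ => norm_oscInt_integrand_le n z θ
    simpa [abs_of_nonneg hδ] using this
  rcases le_or_gt 1 z with h1 | h1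
  · have hs1 : 1 ≤ √z := Real.one_le_sqrt.2 h1
    have hδ1 : 1 / √z ≤ 1 := by rwa [div_le_one hs]
    have hi := fun a b => (continuous_oscInt_integrand n z).intervalIntegrable (μ := volume) a b
    rw [oscInt, ← intervalIntegral.integral_add_adjacent_intervals (hi 0 (1 / √z)) (hi _ _)]
    calc _ ≤ _ := norm_add_le _ _
      _ ≤ 1 / √z + 4 / (z * (1 / √z)) :=
        add_le_add (hhead _ (by positivity))
          (norm_oscInt_tail_le hn hz (by positivity) (by linarith))
      _ = 5 / √z := by
        have : z = √z * √z := (Real.mul_self_sqrt hz.le).symm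
        rw [show z * (1 / √z) = √z by rw [mul_one_div, div_eq_iff hs.ne']; exact this]
        ring
  · have hs1 : √z ≤ 1 := Real.sqrt_le_one.2 h1.le
    calc _ ≤ Real.pi / 2 := hhead _ (by positivity)
      _ ≤ 5 / 1 := by linarith
      _ ≤ 5 / √z := by gcongr

theorem tendsto_sinh_atTop : Tendsto Real.sinh atTop atTop :=
  tendsto_atTop_mono' _ ((eventually_ge_atTop 0).mono fun _ h => Real.self_le_sinh_iff.2 h)
    tendsto_id

theorem hasDerivAt_neg_exp_neg_mul_sinh_div {z : ℝ} (hz : 0 < z) (s : ℝ) :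
    HasDerivAt (fun s => -Real.exp (-z * Real.sinh s) / z)
      (Real.cosh s * Real.exp (-z * Real.sinh s)) s := by
  refine (((Real.hasDerivAt_sinh s).const_mul (-z)).exp.neg.div_const z).congr_deriv ?_
  field_simp

theorem tendsto_neg_exp_neg_mul_sinh_div {z : ℝ} (hz : 0 < z) :
    Tendsto (fun s => -Real.exp (-z * Real.sinh s) / z) atTop (nhds 0) := by
  have h : Tendsto (fun s => -z * Real.sinh s) atTop atBot :=
    tendsto_sinh_atTop.const_mul_atTop_of_neg (neg_lt_zero.2 hz)
  simpa using ((Real.tendsto_exp_atBot.comp h).neg.div_const z)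

theorem integrableOn_cosh_mul_exp {z : ℝ} (hz : 0 < z) :
    IntegrableOn (fun s => Real.cosh s * Real.exp (-z * Real.sinh s)) (Ioi 0) :=
  integrableOn_Ioi_deriv_of_nonneg' (fun s _ => hasDerivAt_neg_exp_neg_mul_sinh_div hz s)
    (fun s _ => mul_nonneg (Real.cosh_pos s).le (Real.exp_pos _).le)
    (tendsto_neg_exp_neg_mul_sinh_div hz)

theorem integral_cosh_mul_exp {z : ℝ} (hz : 0 < z) :
    ∫ s in Ioi (0:ℝ), Real.cosh s * Real.exp (-z * Real.sinh s) = 1 / z := by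
  rw [integral_Ioi_of_hasDerivAt_of_tendsto' (fun s _ => hasDerivAt_neg_exp_neg_mul_sinh_div hz s)
    (integrableOn_cosh_mul_exp hz) (tendsto_neg_exp_neg_mul_sinh_div hz)]
  simp [neg_div]

theorem integrableOn_mul_exp_of_abs_le_cosh {f : ℝ → ℝ} (hf : Continuous f)
    (hle : ∀ s, |f s| ≤ Real.cosh s) {z : ℝ} (hz : 0 < z) :
    IntegrableOn (fun s => f s * Real.exp (-z * Real.sinh s)) (Ioi 0) := by
  refine (integrableOn_cosh_mul_exp hz).mono' (by fun_prop) (Eventually.of_forall fun s => ?_)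
  rw [norm_mul, Real.norm_eq_abs, Real.norm_of_nonneg (Real.exp_pos _).le]
  exact mul_le_mul_of_nonneg_right (hle s) (Real.exp_pos _).le

theorem abs_sinh_le_cosh (s : ℝ) : |Real.sinh s| ≤ Real.cosh s := by
  rw [abs_le, Real.sinh_eq, Real.cosh_eq]
  constructor <;> linarith [Real.exp_pos s, Real.exp_pos (-s)]

theorem integrableOn_exp_neg_mul_sinh {z : ℝ} (hz : 0 < z) :
    IntegrableOn (fun s => Real.exp (-z * Real.sinh s)) (Ioi 0) := by
  simpa using integrableOn_mul_exp_of_abs_le_cosh (f := fun _ => 1) continuous_const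
    (fun s => by simp) hz

theorem integrableOn_sinh_mul_exp {z : ℝ} (hz : 0 < z) :
    IntegrableOn (fun s => Real.sinh s * Real.exp (-z * Real.sinh s)) (Ioi 0) :=
  integrableOn_mul_exp_of_abs_le_cosh Real.continuous_sinh abs_sinh_le_cosh hz

/-- The damped integral `∫₀^∞ e^{-s} e^{-z sinh s} ds`. -/
def dampedInt (z : ℝ) : ℝ := ∫ s in Ioi (0:ℝ), Real.exp (-s) * Real.exp (-z * Real.sinh s)

theorem integrableOn_dampedInt {z : ℝ} (hz : 0 < z) :
    IntegrableOn (fun s => Real.exp (-s) * Real.exp (-z * Real.sinh s)) (Ioi 0) := by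
  refine (integrableOn_exp_neg_mul_sinh hz).mono' (by fun_prop)
    ((ae_restrict_iff' measurableSet_Ioi).2 (Eventually.of_forall fun s hs => ?_))
  rw [Real.norm_of_nonneg (by positivity)]
  have : Real.exp (-s) ≤ 1 := Real.exp_le_one_iff.2 (neg_nonpos.2 (le_of_lt hs))
  exact mul_le_of_le_one_left (Real.exp_pos _).le this

theorem hasDerivAt_integral_exp_neg_mul_sinh {z : ℝ} (hz : 0 < z) :
    HasDerivAt (fun z => ∫ s in Ioi (0:ℝ), Real.exp (-z * Real.sinh s))
      (dampedInt z - 1 / z) z := by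
  have key := (hasDerivAt_integral_of_dominated_loc_of_deriv_le
    (μ := volume.restrict (Ioi (0:ℝ))) (x₀ := z) (s := Ioi (z / 2))
    (bound := fun s => Real.sinh s * Real.exp (-(z / 2) * Real.sinh s))
    (F := fun z s => Real.exp (-z * Real.sinh s))
    (F' := fun z s => -(Real.sinh s * Real.exp (-z * Real.sinh s)))
    (Ioi_mem_nhds (by linarith))
    (Eventually.of_forall fun w => by fun_prop) (integrableOn_exp_neg_mul_sinh hz)
    (by fun_prop)
    ((ae_restrict_iff' measurableSet_Ioi).2 (Eventually.of_forall fun s hs w hw => ?_))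
    (integrableOn_sinh_mul_exp (by positivity))
    (Eventually.of_forall fun s w _ => ?_)).2
  · refine key.congr_deriv ?_
    rw [integral_neg, ← integral_cosh_mul_exp hz, dampedInt,
      ← integral_sub (integrableOn_dampedInt hz) (integrableOn_cosh_mul_exp hz), ← integral_neg]
    refine integral_congr_ae (Eventually.of_forall fun s => ?_)
    simp only [Real.sinh_eq, Real.cosh_eq]
    ring
  · have hs' : 0 < Real.sinh s := Real.sinh_pos_iff.2 hs
    rw [norm_neg, Real.norm_of_nonneg (by positivity)]
    have : -w * Real.sinh s ≤ -(z / 2) * Real.sinh s :=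
      mul_le_mul_of_nonneg_right (neg_le_neg (le_of_lt hw)) hs'.le
    gcongr
  · have h1 : HasDerivAt (fun w : ℝ => -w * Real.sinh s) (-1 * Real.sinh s) w :=
      (hasDerivAt_id w).neg.mul_const _
    exact h1.exp.congr_deriv (by ring)

theorem dampedInt_le {z : ℝ} (hz : 0 < z) : dampedInt z ≤ 1 / √z := by
  have hle : dampedInt z ≤ ∫ s in Ioi (0:ℝ), Real.exp (-(1 + z) * s) := by
    refine setIntegral_mono_on (integrableOn_dampedInt hz)
      (integrableOn_exp_mul_Ioi (by linarith) 0) measurableSet_Ioi fun s hs => ?_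
    rw [← Real.exp_add, Real.exp_le_exp]
    nlinarith [Real.self_le_sinh_iff.2 (le_of_lt hs)]
  rw [integral_exp_mul_Ioi (by linarith)] at hle
  refine hle.trans ?_
  rw [mul_zero, Real.exp_zero, neg_div_neg_eq]
  refine one_div_le_one_div_of_le (Real.sqrt_pos.2 hz) ?_
  nlinarith [Real.sq_sqrt hz.le, sq_nonneg (√z - 1)]

theorem dampedInt_sub_nonneg {z w : ℝ} (hz : 0 < z) (hzw : z ≤ w) :
    0 ≤ dampedInt z - dampedInt w := by
  rw [sub_nonneg]
  refine setIntegral_mono_on (integrableOn_dampedInt (hz.trans_le hzw))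
    (integrableOn_dampedInt hz) measurableSet_Ioi fun s hs => ?_
  have hs' : 0 < Real.sinh s := Real.sinh_pos_iff.2 hs
  have : -w * Real.sinh s ≤ -z * Real.sinh s :=
    mul_le_mul_of_nonneg_right (neg_le_neg hzw) hs'.le
  gcongr

theorem dampedInt_nonneg (z : ℝ) : 0 ≤ dampedInt z :=
  integral_nonneg fun _ => by positivity

theorem exp_neg_mul_sinh_mul_exp_le {z s : ℝ} (hz : 0 < z) (hs : 0 < s) :
    Real.exp (-s) * (Real.sinh s * Real.exp (-z * Real.sinh s)) ≤
      1 / √z * Real.exp (-(1 / 2) * s) := by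
  set h := Real.sinh s with hh
  have hpos : 0 < h := Real.sinh_pos_iff.2 hs
  have hsz := Real.sqrt_pos.2 hz
  have hsh := Real.sqrt_pos.2 hpos
  have e1 : √z * √h * Real.exp (-z * h) ≤ 1 := by
    have hx : √z * √h ≤ Real.exp (z * h) := by
      have h2 := Real.add_one_le_exp (z * h)
      nlinarith [Real.sq_sqrt hz.le, Real.sq_sqrt hpos.le, sq_nonneg (√z * √h - 1),
        mul_pow (√z) (√h) 2]
    rw [neg_mul, Real.exp_neg, ← div_eq_mul_inv, div_le_one (Real.exp_pos _)]
    exact hx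
  have e2 : √h ≤ Real.exp (1 / 2 * s) := by
    rw [Real.sqrt_le_left (Real.exp_pos _).le, ← Real.exp_nat_mul]
    rw [show ((2:ℕ):ℝ) * (1 / 2 * s) = s by push_cast; ring, hh, Real.sinh_eq]
    linarith [Real.exp_pos s, Real.exp_pos (-s)]
  have e3 : h * Real.exp (-z * h) ≤ √h / √z := by
    rw [le_div_iff₀ hsz]
    calc h * Real.exp (-z * h) * √z = √h * (√z * √h * Real.exp (-z * h)) := by
          nth_rewrite 1 [← Real.mul_self_sqrt hpos.le]; ring
      _ ≤ √h * 1 := by gcongr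
      _ = √h := mul_one _
  calc _ ≤ Real.exp (-s) * (Real.exp (1 / 2 * s) / √z) := by
        refine mul_le_mul_of_nonneg_left (e3.trans ?_) (Real.exp_pos _).le
        gcongr
    _ = 1 / √z * (Real.exp (-s) * Real.exp (1 / 2 * s)) := by ring
    _ = _ := by rw [← Real.exp_add]; congr 2; ring

theorem dampedInt_sub_le {z w : ℝ} (hz : 0 < z) (hzw : z ≤ w) :
    dampedInt z - dampedInt w ≤ 2 / √z * (w - z) := by
  rw [dampedInt, dampedInt,
    ← integral_sub (integrableOn_dampedInt hz) (integrableOn_dampedInt (hz.trans_le hzw))]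
  have hI : IntegrableOn (fun s => (w - z) * (1 / √z * Real.exp (-(1 / 2) * s))) (Ioi 0) :=
    ((integrableOn_exp_mul_Ioi (by norm_num) 0).const_mul _).const_mul _
  calc _ ≤ ∫ s in Ioi (0:ℝ), (w - z) * (1 / √z * Real.exp (-(1 / 2) * s)) := by
        refine setIntegral_mono_on ((integrableOn_dampedInt hz).sub
          (integrableOn_dampedInt (hz.trans_le hzw))) hI measurableSet_Ioi fun s hs => ?_
        refine le_trans ?_ (mul_le_mul_of_nonneg_left (exp_neg_mul_sinh_mul_exp_le hz hs)
          (sub_nonneg.2 hzw))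
        have h1 : 1 - Real.exp (-(w - z) * Real.sinh s) ≤ (w - z) * Real.sinh s := by
          have := Real.add_one_le_exp (-(w - z) * Real.sinh s)
          linarith
        calc _ = Real.exp (-s) * Real.exp (-z * Real.sinh s) *
              (1 - Real.exp (-(w - z) * Real.sinh s)) := by
              rw [mul_sub, mul_one, mul_assoc (Real.exp (-s)), ← Real.exp_add (-z * Real.sinh s)]
              congr 3
              ring
          _ ≤ Real.exp (-s) * Real.exp (-z * Real.sinh s) * ((w - z) * Real.sinh s) := by gcongr
          _ = _ := by ring
    _ = _ := by
        rw [integral_const_mul, integral_const_mul, integral_exp_mul_Ioi (by norm_num)]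
        simp
        ring

theorem norm_exp_I_mul_cosh (z T y : ℝ) :
    ‖Complex.exp (Complex.I * z * Complex.cosh (T + y * Complex.I))‖ =
      Real.exp (-(z * Real.sin y) * Real.sinh T) := by
  rw [Complex.norm_exp, Complex.cosh_add, Complex.cosh_mul_I, Complex.sinh_mul_I,
    ← Complex.ofReal_cosh, ← Complex.ofReal_sinh, ← Complex.ofReal_cos, ← Complex.ofReal_sin]
  congr 1
  simp [-Complex.ofReal_cosh, -Complex.ofReal_sinh, -Complex.ofReal_cos, -Complex.ofReal_sin]
  ring

/-- The vertical side of the contour at abscissa `T` contributes nothing as `T → ∞`. -/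
theorem tendsto_integral_vertical {z : ℝ} (hz : 0 < z) :
    Tendsto (fun T : ℝ => ∫ y in (0:ℝ)..(Real.pi / 2),
      Complex.exp (Complex.I * z * Complex.cosh (T + y * Complex.I))) atTop (nhds 0) := by
  have hpi := Real.pi_pos
  have hpos : ∀ y ∈ uIoc (0:ℝ) (Real.pi / 2), 0 < z * Real.sin y := by
    intro y hy
    rw [uIoc_of_le (by positivity)] at hy
    exact mul_pos hz (Real.sin_pos_of_pos_of_lt_pi hy.1 (by linarith [hy.2]))
  have key := intervalIntegral.tendsto_integral_filter_of_dominated_convergence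
    (μ := volume) (a := 0) (b := Real.pi / 2) (l := atTop) (f := fun _ => (0:ℂ))
    (F := fun (T y : ℝ) => Complex.exp (Complex.I * z * Complex.cosh (T + y * Complex.I)))
    (fun _ => (1:ℝ)) (Eventually.of_forall fun T => by
      refine Continuous.aestronglyMeasurable ?_
      exact Complex.continuous_exp.comp
        (continuous_const.mul (Complex.continuous_cosh.comp (by fun_prop))))
    ((eventually_ge_atTop 0).mono fun T hT => Eventually.of_forall fun y hy => ?_)
    (by simp) (Eventually.of_forall fun y hy => ?_)
  · simpa using key
  · rw [norm_exp_I_mul_cosh, Real.exp_le_one_iff, neg_mul]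
    exact neg_nonpos.2 (mul_nonneg (hpos y hy).le (Real.sinh_nonneg_iff.2 hT))
  · rw [tendsto_zero_iff_norm_tendsto_zero]
    simp only [norm_exp_I_mul_cosh]
    exact Real.tendsto_exp_atBot.comp
      (tendsto_sinh_atTop.const_mul_atTop_of_neg (neg_lt_zero.2 (hpos y hy)))

/-- Rotating the contour `[0, T]` to `[0, iπ/2] ∪ [iπ/2, iπ/2 + T]`. -/
theorem integral_exp_cosh_eq (z T : ℝ) :
    ∫ t in (0:ℝ)..T, Complex.exp (Complex.I * z * Complex.cosh t) =
      ((∫ t in (0:ℝ)..T, Real.exp (-z * Real.sinh t) : ℝ) : ℂ) + Complex.I * oscInt 0 z -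
      Complex.I * ∫ y in (0:ℝ)..(Real.pi / 2),
        Complex.exp (Complex.I * z * Complex.cosh (T + y * Complex.I)) := by
  have h := Complex.integral_boundary_rect_eq_zero_of_differentiableOn
    (fun w => Complex.exp (Complex.I * z * Complex.cosh w)) 0 (T + (Real.pi / 2 : ℝ) * Complex.I)
    (Complex.differentiable_exp.comp
      (Complex.differentiable_cosh.const_mul (Complex.I * z))).differentiableOn
  have hre : (T + (Real.pi / 2 : ℝ) * Complex.I : ℂ).re = T := by simp
  have him : (T + (Real.pi / 2 : ℝ) * Complex.I : ℂ).im = Real.pi / 2 := by simp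
  rw [hre, him] at h
  simp only [Complex.zero_re, Complex.zero_im, Complex.ofReal_zero, zero_mul, add_zero, zero_add,
    smul_eq_mul] at h
  have htop : ∀ t : ℝ, Complex.exp (Complex.I * z *
      Complex.cosh (t + (Real.pi / 2 : ℝ) * Complex.I)) =
      ((Real.exp (-z * Real.sinh t) : ℝ) : ℂ) := by
    intro t
    rw [Complex.cosh_add, Complex.cosh_mul_I, Complex.sinh_mul_I, ← Complex.ofReal_cos,
      ← Complex.ofReal_sin, Real.cos_pi_div_two, Real.sin_pi_div_two]
    push_cast
    congr 1
    linear_combination (z * Complex.sinh t) * Complex.I_sq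
  have hside : ∀ y : ℝ, Complex.exp (Complex.I * z * Complex.cosh (y * Complex.I)) =
      ((Real.cos y : ℝ) : ℂ) ^ 0 * Complex.exp (Complex.I * z * (Real.cos y : ℝ)) := by
    intro y
    rw [Complex.cosh_mul_I, pow_zero, one_mul, Complex.ofReal_cos]
  simp only [htop, hside, intervalIntegral.integral_ofReal] at h
  rw [oscInt]
  linear_combination h

theorem re_integral_exp_cosh (z T : ℝ) :
    (∫ t in (0:ℝ)..T, Complex.exp (Complex.I * z * Complex.cosh t)).re =
      ∫ t in (0:ℝ)..T, Real.cos (z * Real.cosh t) := by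
  rw [← Complex.reCLM_apply, ← Complex.reCLM.intervalIntegral_comp_comm]
  · refine intervalIntegral.integral_congr fun t _ => ?_
    simp only [Complex.reCLM_apply, ← Complex.ofReal_cosh]
    rw [show Complex.I * (z:ℂ) * ((Real.cosh t : ℝ) : ℂ) = ((z * Real.cosh t : ℝ) : ℂ) * Complex.I
      by push_cast; ring, Complex.exp_ofReal_mul_I_re]
  · exact (Complex.continuous_exp.comp (continuous_const.mul
      (Complex.continuous_cosh.comp Complex.continuous_ofReal))).intervalIntegrable _ _

theorem Y0_eq {z : ℝ} (hz : 0 < z) :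
    Y0 z = 2 / Real.pi *
      ((oscInt 0 z).im - ∫ s in Ioi (0:ℝ), Real.exp (-z * Real.sinh s)) := by
  have h1 := intervalIntegral_tendsto_integral_Ioi 0 (integrableOn_exp_neg_mul_sinh hz) tendsto_id
  have h2 := ((Complex.continuous_im.tendsto _).comp (tendsto_integral_vertical hz))
  have h3 : Tendsto (fun T : ℝ => ∫ t in (0:ℝ)..T, Real.cos (z * Real.cosh t)) atTop
      (nhds ((∫ s in Ioi (0:ℝ), Real.exp (-z * Real.sinh s)) - (oscInt 0 z).im + 0)) := by
    refine ((h1.sub_const (oscInt 0 z).im).add h2).congr fun T => ?_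
    rw [← re_integral_exp_cosh, integral_exp_cosh_eq, Complex.sub_re, Complex.add_re,
      Complex.I_mul_re, Complex.I_mul_re, Complex.ofReal_re]
    simp only [id, Function.comp_apply]
    ring
  rw [Y0, h3.limUnder_eq]
  ring

theorem J0_eq (z : ℝ) : J0 z = 2 / Real.pi * (oscInt 0 z).re := by
  have hre : (oscInt 0 z).re = ∫ θ in (0:ℝ)..(Real.pi / 2), Real.cos (z * Real.cos θ) := by
    rw [oscInt, ← Complex.reCLM_apply, ← Complex.reCLM.intervalIntegral_comp_comm
      ((continuous_oscInt_integrand 0 z).intervalIntegrable _ _)]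
    refine intervalIntegral.integral_congr fun θ _ => ?_
    simp only [Complex.reCLM_apply, pow_zero, one_mul]
    rw [show Complex.I * (z:ℂ) * ((Real.cos θ : ℝ) : ℂ) = ((z * Real.cos θ : ℝ) : ℂ) * Complex.I
      by push_cast; ring, Complex.exp_ofReal_mul_I_re]
  have hi : ∀ a b, IntervalIntegrable (fun θ => Real.cos (z * Real.cos θ)) volume a b :=
    fun a b => Continuous.intervalIntegrable (by fun_prop) a b
  have h1 := intervalIntegral.integral_comp_sub_left (a := 0) (b := Real.pi)
    (fun θ => Real.cos (z * Real.cos θ)) (Real.pi / 2)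
  have h2 := intervalIntegral.integral_comp_neg (a := 0) (b := Real.pi / 2)
    (fun θ => Real.cos (z * Real.cos θ))
  have h3 := intervalIntegral.integral_add_adjacent_intervals
    (hi (-(Real.pi / 2)) 0) (hi 0 (Real.pi / 2))
  simp only [Real.cos_pi_div_two_sub, Real.cos_neg, sub_zero, neg_zero] at h1 h2
  rw [show Real.pi / 2 - Real.pi = -(Real.pi / 2) by ring, ← h3, ← h2] at h1
  rw [J0, h1, hre]
  ring

theorem hasDerivAt_J0 (z : ℝ) :
    HasDerivAt J0 (2 / Real.pi * (Complex.I * oscInt 1 z).re) z := by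
  rw [show J0 = fun z => 2 / Real.pi * (oscInt 0 z).re from funext J0_eq]
  exact (Complex.reCLM.hasFDerivAt.comp_hasDerivAt z (hasDerivAt_oscInt 0 z)).const_mul _

theorem hasDerivAt_Y0 {z : ℝ} (hz : 0 < z) :
    HasDerivAt Y0
      (2 / Real.pi * ((Complex.I * oscInt 1 z).im - (dampedInt z - 1 / z))) z := by
  refine HasDerivAt.congr_of_eventuallyEq (f := fun z => 2 / Real.pi *
      ((oscInt 0 z).im - ∫ s in Ioi (0:ℝ), Real.exp (-z * Real.sinh s))) ?_ ?_
  · exact ((Complex.imCLM.hasFDerivAt.comp_hasDerivAt z (hasDerivAt_oscInt 0 z)).sub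
      (hasDerivAt_integral_exp_neg_mul_sinh hz)).const_mul _
  · filter_upwards [Ioi_mem_nhds hz] with w hw using Y0_eq hw

/-- The profile of `∂_λ E₀^±`: `∂_λ E₀^±(λ)(x,y) = |x−y|/(2π) · E0Profile (λ|x−y|)`. -/
def E0Profile (ε z : ℝ) : ℂ :=
  ε * Complex.I * ((Complex.I * oscInt 1 z).re : ℂ) - ((Complex.I * oscInt 1 z).im : ℂ) +
    (dampedInt z : ℂ)

theorem hasDerivAt_E0 {ε : ℝ} (hε : ε = 1 ∨ ε = -1) {s : ℝ} (hs : 0 < s) {x y : Plane}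
    (hxy : x ≠ y) :
    HasDerivAt (fun s => E0 ε s x y)
      (((‖x - y‖ / (2 * Real.pi) : ℝ) : ℂ) * E0Profile ε (s * ‖x - y‖)) s := by
  have hr : 0 < ‖x - y‖ := norm_pos_iff.2 (sub_ne_zero.2 hxy)
  set r := ‖x - y‖ with hrdef
  have hsr : 0 < s * r := mul_pos hs hr
  have hmul : HasDerivAt (fun s : ℝ => s * r) r s := by simpa using (hasDerivAt_id s).mul_const r
  have hJ := ((hasDerivAt_J0 (s * r)).comp s hmul).ofReal_comp
  have hY := ((hasDerivAt_Y0 hsr).comp s hmul).ofReal_comp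
  have hlog : HasDerivAt (fun s : ℝ => Real.log (s / 2)) (1 / s) s := by
    refine (((hasDerivAt_id s).div_const 2).log (by simpa using hs.ne')).congr_deriv ?_
    simp only [id]
    field_simp
  have hE := ((((hJ.add (hY.const_mul (ε * Complex.I))).const_mul (ε * (Complex.I / 4))).sub
    (((hasDerivAt_const s (ε * Complex.I / 4)).sub
      (hlog.ofReal_comp.const_mul (1 / (2 * Real.pi) : ℂ))).sub_const
        ((Real.eulerMascheroniConstant / (2 * Real.pi) : ℝ) : ℂ))).add_const
      ((1 / (2 * Real.pi)) * (Real.log r : ℂ)))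
  refine hE.congr_deriv ?_
  have hε2 : (ε : ℂ) ^ 2 = 1 := by rcases hε with rfl | rfl <;> norm_num
  have hpi : (Real.pi : ℂ) ≠ 0 := by exact_mod_cast Real.pi_ne_zero
  have hsC : (s : ℂ) ≠ 0 := by exact_mod_cast hs.ne'
  have hrC : (r : ℂ) ≠ 0 := by exact_mod_cast hr.ne'
  rw [E0Profile]
  generalize (Complex.I * oscInt 1 (s * r)).re = p
  generalize (Complex.I * oscInt 1 (s * r)).im = q
  generalize dampedInt (s * r) = d
  push_cast
  have key : (ε : ℂ) * (Complex.I / 4) * (ε * Complex.I * (2 / Real.pi * (q - (d - 1 / (s * r))) * r))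
      = -(1 / 4) * (2 / Real.pi * (q - (d - 1 / (s * r))) * r) := by
    linear_combination (2 / Real.pi * (q - (d - 1 / (s * r))) * r / 4 : ℂ) *
      (Complex.I ^ 2 * hε2 + Complex.I_sq)
  rw [mul_add, key]
  field_simp
  ring

theorem norm_E0Profile_sub_le {ε : ℝ} (hε : ε = 1 ∨ ε = -1) (z w : ℝ) :
    ‖E0Profile ε w - E0Profile ε z‖ ≤
      2 * ‖oscInt 1 w - oscInt 1 z‖ + |dampedInt z - dampedInt w| := by
  set D := Complex.I * oscInt 1 w - Complex.I * oscInt 1 z with hD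
  have hDn : ‖D‖ = ‖oscInt 1 w - oscInt 1 z‖ := by
    rw [hD, ← mul_sub, norm_mul, Complex.norm_I, one_mul]
  have heq : E0Profile ε w - E0Profile ε z =
      ε * Complex.I * (D.re : ℂ) - (D.im : ℂ) - ((dampedInt z - dampedInt w : ℝ) : ℂ) := by
    rw [E0Profile, E0Profile, hD, Complex.sub_re, Complex.sub_im]
    push_cast
    ring
  have hεn : ‖(ε : ℂ)‖ = 1 := by rcases hε with rfl | rfl <;> simp
  rw [heq, ← hDn]
  refine (norm_sub_le _ _).trans (add_le_add ((norm_sub_le _ _).trans ?_) (le_of_eq ?_))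
  · rw [norm_mul, norm_mul, hεn, Complex.norm_I, Complex.norm_real, Complex.norm_real,
      Real.norm_eq_abs, Real.norm_eq_abs]
    linarith [Complex.abs_re_le_norm D, Complex.abs_im_le_norm D]
  · rw [Complex.norm_real, Real.norm_eq_abs]

theorem norm_oscInt_sub_le {z w : ℝ} (hz : 0 < z) (hzw : z ≤ w) :
    ‖oscInt 1 w - oscInt 1 z‖ ≤ 5 / √z * (w - z) := by
  have := (convex_Icc z w).norm_image_sub_le_of_norm_hasDerivWithin_le
    (fun t _ => (hasDerivAt_oscInt 1 t).hasDerivWithinAt) (C := 5 / √z) (fun t ht => ?_)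
    (left_mem_Icc.2 hzw) (right_mem_Icc.2 hzw)
  · rwa [Real.norm_of_nonneg (sub_nonneg.2 hzw)] at this
  · have hsz := Real.sqrt_pos.2 hz
    rw [norm_mul, Complex.norm_I, one_mul]
    refine (norm_oscInt_le two_ne_zero (hz.trans_le ht.1)).trans ?_
    have := Real.sqrt_le_sqrt ht.1
    gcongr

theorem E0Profile_holder {α : ℝ} (hα : 0 < α) (hα1 : α < 1) {ε : ℝ} (hε : ε = 1 ∨ ε = -1)
    {z w : ℝ} (hz : 0 < z) (hzw : z < w) :
    ‖E0Profile ε w - E0Profile ε z‖ ≤ 22 / √z * (w - z) ^ α := by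
  have hδ : 0 < w - z := sub_pos.2 hzw
  have hsz := Real.sqrt_pos.2 hz
  have hsw : √z ≤ √w := Real.sqrt_le_sqrt hzw.le
  refine (norm_E0Profile_sub_le hε z w).trans ?_
  rw [abs_of_nonneg (dampedInt_sub_nonneg hz hzw.le)]
  rcases le_total (w - z) 1 with h | h
  · have hp : w - z ≤ (w - z) ^ α := by
      simpa using Real.rpow_le_rpow_of_exponent_ge hδ h hα1.le
    calc _ ≤ 2 * (5 / √z * (w - z)) + 2 / √z * (w - z) := by
          gcongr
          · exact norm_oscInt_sub_le hz hzw.le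
          · exact dampedInt_sub_le hz hzw.le
      _ = 12 / √z * (w - z) := by ring
      _ ≤ 22 / √z * (w - z) ^ α := by gcongr; norm_num
  · have hp : 1 ≤ (w - z) ^ α := Real.one_le_rpow h hα.le
    have h1 : ‖oscInt 1 w - oscInt 1 z‖ ≤ 5 / √z + 5 / √z := by
      refine (norm_sub_le _ _).trans (add_le_add ?_ (norm_oscInt_le one_ne_zero hz))
      refine (norm_oscInt_le one_ne_zero (hz.trans hzw)).trans ?_
      gcongr
    calc _ ≤ 2 * (5 / √z + 5 / √z) + 1 / √z := by
          gcongr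
          linarith [dampedInt_le hz, dampedInt_nonneg w]
      _ = 21 / √z * 1 := by ring
      _ ≤ 22 / √z * (w - z) ^ α := by gcongr; norm_num

/-- Hölder continuity of `∂_λ E₀^±`: for `0 < α < 1` there is `C` such that
for all `b > a > 0` and `x ≠ y`,
`|∂_λE₀^±(b)(x,y) − ∂_λE₀^±(a)(x,y)| ≤ C a^{−1/2}(b−a)^α |x−y|^{1/2+α}`. -/
theorem free_resolvent_error_deriv_holder (α : ℝ) (hα : 0 < α) (hα1 : α < 1) :
    ∃ C : ℝ, 0 < C ∧ ∀ ε : ℝ, (ε = 1 ∨ ε = -1) →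
      ∀ a b : ℝ, 0 < a → a < b → ∀ x y : Plane, x ≠ y →
        ‖deriv (fun s : ℝ => E0 ε s x y) b - deriv (fun s : ℝ => E0 ε s x y) a‖ ≤
          C * a ^ (-(1:ℝ)/2) * (b - a) ^ α * ‖x - y‖ ^ ((1:ℝ)/2 + α) := by
  refine ⟨22, by norm_num, fun ε hε a b ha hab x y hxy => ?_⟩
  rw [(hasDerivAt_E0 hε (ha.trans hab) hxy).deriv, (hasDerivAt_E0 hε ha hxy).deriv, ← mul_sub,
    norm_mul, Complex.norm_real]
  have hr : 0 < ‖x - y‖ := norm_pos_iff.2 (sub_ne_zero.2 hxy)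
  set r := ‖x - y‖
  have hpi := Real.pi_gt_three
  have hh := E0Profile_holder hα hα1 hε (mul_pos ha hr) (mul_lt_mul_of_pos_right hab hr)
  have hr' : ‖r / (2 * Real.pi)‖ ≤ r := by
    rw [Real.norm_of_nonneg (by positivity)]
    exact div_le_self hr.le (by linarith)
  have hsa : a ^ (-(1:ℝ)/2) = 1 / √a := by
    rw [neg_div, Real.rpow_neg ha.le, ← Real.sqrt_eq_rpow, one_div]
  have hsr := Real.sqrt_pos.2 hr
  calc _ ≤ r * (22 / √(a * r) * (b * r - a * r) ^ α) := by gcongr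
    _ = 22 * (1 / √a) * (b - a) ^ α * (√r * r ^ α) := by
        rw [← sub_mul, Real.mul_rpow (sub_pos.2 hab).le hr.le, Real.sqrt_mul ha.le]
        nth_rewrite 1 [← Real.mul_self_sqrt hr.le]
        field_simp
    _ = _ := by rw [hsa, Real.rpow_add hr, ← Real.sqrt_eq_rpow]
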